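/- Let α be irrational with 0 < α < 1, let 0 < β < 1 and let (b_i) be the Davenport coefficients of β. Then there exist integers q ≥ 1 and p with β = qα − p if and only if there is some n ≥ 1 such that b_i = 0 for all i > n; and in that case q = Σ_{k=1}^n b_k q_{k−1} and p = Σ_{k=1}^n b_k p_{k−1}. -/

import Mathlib

open Filter Finset

/-- Distance from `x` to the nearest integer. -/
noncomputable def nint (x : ℝ) : ℝ := |x - (round x : ℝ)|

/-- One-sided inhomogeneous approximation constant
`M₊(α,β) = liminf_{q→∞} q‖qα−β‖` over positive integers `q`. -/
noncomputable def Mplus (α β : ℝ) : ℝ :=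
  Filter.liminf (fun q : ℕ => (q : ℝ) * nint (q * α - β)) Filter.atTop

/-- Complete quotients of the negative continued fraction: `ncq α i = α_{i+1}`,
so `ncq α 0 = α₁ = α` and `α_{i+1} = a_i - 1/α_i` with `a_i = ⌈1/α_i⌉`. -/
noncomputable def ncq (α : ℝ) : ℕ → ℝ
  | 0 => α
  | i + 1 => (⌈(ncq α i)⁻¹⌉ : ℝ) - (ncq α i)⁻¹

/-- Partial quotients of the negative continued fraction: `npq α i = a_i = ⌈1/α_i⌉` for `i ≥ 1`. -/
noncomputable def npq (α : ℝ) (i : ℕ) : ℤ := ⌈(ncq α (i - 1))⁻¹⌉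

/-- Convergent denominators: `q₀ = 1`, `q₁ = a₁`, `q_{i+2} = a_{i+2} q_{i+1} − q_i`. -/
noncomputable def nq (α : ℝ) : ℕ → ℤ
  | 0 => 1
  | 1 => npq α 1
  | i + 2 => npq α (i + 2) * nq α (i + 1) - nq α i

/-- Convergent numerators: `p₀ = 0`, `p₁ = 1`, `p_{i+2} = a_{i+2} p_{i+1} − p_i`. -/
noncomputable def np (α : ℝ) : ℕ → ℤ
  | 0 => 0
  | 1 => 1
  | i + 2 => npq α (i + 2) * np α (i + 1) - np α i

/-- `Dk α k = α₁α₂⋯α_k` (with `Dk α 0 = 1`). -/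
noncomputable def Dk (α : ℝ) (k : ℕ) : ℝ := ∏ j ∈ Finset.range k, ncq α j

/-- Davenport remainders: `drem α β i = β_{i+1}`, so `drem α β 0 = β₁ = β` and
`β_{i+1} = β_i/α_i − ⌊β_i/α_i⌋`. -/
noncomputable def drem (α β : ℝ) : ℕ → ℝ
  | 0 => β
  | i + 1 => Int.fract (drem α β i / ncq α i)

/-- Davenport coefficients: `db α β i = b_i = ⌊β_i/α_i⌋` for `i ≥ 1`. -/
noncomputable def db (α β : ℝ) (i : ℕ) : ℤ := ⌊drem α β (i - 1) / ncq α (i - 1)⌋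

/-- `Qn α β n = Σ_{k=1}^n b_k q_{k−1}`. -/
noncomputable def Qn (α β : ℝ) (n : ℕ) : ℤ :=
  ∑ k ∈ Finset.Icc 1 n, db α β k * nq α (k - 1)

/-- `Q′_n`. -/
noncomputable def Qn' (α β : ℝ) (n : ℕ) : ℤ :=
  if Qn α β n < nq α n - nq α (n - 1) then Qn α β n + nq α (n - 1)
  else Qn α β n + nq α (n - 1) - nq α n

/-- `λ_n(β) = Q_n D_n β_{n+1}`. -/
noncomputable def lam (α β : ℝ) (n : ℕ) : ℝ :=
  (Qn α β n : ℝ) * Dk α n * drem α β n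

/-- `ρ_n(β)`. -/
noncomputable def rho (α β : ℝ) (n : ℕ) : ℝ :=
  if Qn α β n < nq α n - nq α (n - 1)
  then (Qn' α β n : ℝ) * Dk α n * (1 - drem α β n)
  else (Qn' α β n : ℝ) * Dk α n * (1 - ncq α n - drem α β n)

/-- Reversed quotients: `ᾱ₀ = 0`, `ᾱ_i = 1/(a_i − ᾱ_{i−1})`. -/
noncomputable def rq (α : ℝ) : ℕ → ℝ
  | 0 => 0
  | i + 1 => ((npq α (i + 1) : ℝ) - rq α i)⁻¹

theorem ncq_irrational_and_mem_Ioo {α : ℝ} (hirr : Irrational α) (h0 : 0 < α) (h1 : α < 1) (i : ℕ) :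
    Irrational (ncq α i) ∧ 0 < ncq α i ∧ ncq α i < 1 := by
  induction i with
  | zero => exact ⟨hirr, h0, h1⟩
  | succ i ih =>
    have hinv : Irrational (ncq α i)⁻¹ := ih.1.inv
    have hirr' : Irrational (ncq α (i + 1)) := hinv.intCast_sub _
    refine ⟨hirr', lt_of_le_of_ne ?_ hirr'.ne_zero.symm, ?_⟩
    · exact sub_nonneg.2 (Int.le_ceil _)
    · have := Int.ceil_lt_add_one (ncq α i)⁻¹
      simp only [ncq]
      linarith

theorem two_le_npq_succ {α : ℝ} (hirr : Irrational α) (h0 : 0 < α) (h1 : α < 1) (i : ℕ) :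
    2 ≤ npq α (i + 1) := by
  obtain ⟨-, hpos, hlt⟩ := ncq_irrational_and_mem_Ioo hirr h0 h1 i
  have : (1 : ℤ) < ⌈(ncq α i)⁻¹⌉ := Int.lt_ceil.2 (by simpa using (one_lt_inv₀ hpos).2 hlt)
  exact this

theorem one_le_nq {α : ℝ} (hirr : Irrational α) (h0 : 0 < α) (h1 : α < 1) (k : ℕ) :
    1 ≤ nq α k := by
  suffices 1 ≤ nq α k ∧ nq α k ≤ nq α (k + 1) from this.1
  induction k with
  | zero => exact ⟨le_rfl, one_le_two.trans (two_le_npq_succ hirr h0 h1 0)⟩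
  | succ k ih =>
    refine ⟨ih.1.trans ih.2, ?_⟩
    have := two_le_npq_succ hirr h0 h1 (k + 1)
    simp only [nq]
    nlinarith

theorem ncq_succ_mul {α : ℝ} {i : ℕ} (h : ncq α i ≠ 0) :
    ncq α i * ncq α (i + 1) = npq α (i + 1) * ncq α i - 1 := by
  simp only [ncq, npq, Nat.add_sub_cancel]
  field_simp

theorem Dk_succ (α : ℝ) (k : ℕ) : Dk α (k + 1) = Dk α k * ncq α k :=
  Finset.prod_range_succ _ _

theorem Dk_add_two {α : ℝ} {k : ℕ} (h : ncq α k ≠ 0) :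
    Dk α (k + 2) = npq α (k + 1) * Dk α (k + 1) - Dk α k := by
  rw [Dk_succ, Dk_succ, mul_assoc, ncq_succ_mul h]
  ring

theorem Dk_pos {α : ℝ} (hirr : Irrational α) (h0 : 0 < α) (h1 : α < 1) (k : ℕ) : 0 < Dk α k :=
  Finset.prod_pos fun i _ ↦ (ncq_irrational_and_mem_Ioo hirr h0 h1 i).2.1

theorem Dk_succ_lt {α : ℝ} (hirr : Irrational α) (h0 : 0 < α) (h1 : α < 1) (k : ℕ) :
    Dk α (k + 1) < Dk α k := by
  rw [Dk_succ]
  exact mul_lt_of_lt_one_right (Dk_pos hirr h0 h1 k) (ncq_irrational_and_mem_Ioo hirr h0 h1 k).2.2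

theorem Dk_succ_eq_nq_mul_sub_np {α : ℝ} (hirr : Irrational α) (h0 : 0 < α) (h1 : α < 1) (k : ℕ) :
    Dk α (k + 1) = nq α k * α - np α k := by
  have hne (i : ℕ) : ncq α i ≠ 0 := (ncq_irrational_and_mem_Ioo hirr h0 h1 i).2.1.ne'
  induction k using Nat.twoStepInduction with
  | zero => simp [Dk, ncq, nq, np]
  | one =>
    rw [Dk_add_two (hne 0)]
    simp [Dk, ncq, nq, np]
  | more k ih ih' =>
    rw [Dk_add_two (hne _), ih, ih']
    simp only [nq, np]
    push_cast
    ring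

theorem tendsto_Dk_atTop {α : ℝ} (hirr : Irrational α) (h0 : 0 < α) (h1 : α < 1) :
    Tendsto (Dk α) atTop (nhds 0) := by
  have hanti : Antitone (Dk α) := antitone_nat_of_succ_le fun k ↦ (Dk_succ_lt hirr h0 h1 k).le
  have hbdd : BddBelow (Set.range (Dk α)) :=
    ⟨0, by rintro _ ⟨k, rfl⟩; exact (Dk_pos hirr h0 h1 k).le⟩
  have hlim := tendsto_atTop_ciInf hanti hbdd
  have hle (k : ℕ) : ⨅ i, Dk α i ≤ Dk α k := ciInf_le hbdd k
  set L := ⨅ i, Dk α i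
  have hL : 0 ≤ L := le_ciInf fun k ↦ (Dk_pos hirr h0 h1 k).le
  rcases hL.eq_or_lt with hL | hL
  · rwa [← hL] at hlim
  exfalso
  have hlim1 := (tendsto_add_atTop_iff_nat 1).2 hlim
  have hlim2 := (tendsto_add_atTop_iff_nat 2).2 hlim
  have hdiff : Tendsto (fun k ↦ Dk α k - Dk α (k + 1)) atTop (nhds 0) := by
    simpa using hlim.sub hlim1
  have hdiff2 : Tendsto (fun k ↦ (Dk α k - Dk α (k + 1)) - (Dk α (k + 1) - Dk α (k + 2)))
      atTop (nhds 0) := by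
    simpa using (hlim.sub hlim1).sub (hlim1.sub hlim2)
  obtain ⟨N, hN⟩ := eventually_atTop.1 (hdiff2.eventually_lt_const hL)
  have hconst (k : ℕ) (hk : N ≤ k) : Dk α (k + 1) - Dk α (k + 2) = Dk α k - Dk α (k + 1) := by
    have hrec := Dk_add_two (ncq_irrational_and_mem_Ioo hirr h0 h1 k).2.1.ne'
    have hsmall := hN k hk
    have htwo : npq α (k + 1) = 2 := by
      refine le_antisymm (not_lt.1 fun hgt ↦ ?_) (two_le_npq_succ hirr h0 h1 k)
      have hthree : (3 : ℝ) ≤ npq α (k + 1) := by exact_mod_cast hgt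
      nlinarith [hle (k + 1)]
    rw [htwo] at hrec
    push_cast at hrec
    linarith
  have hge (k : ℕ) (hk : N ≤ k) : Dk α k - Dk α (k + 1) = Dk α N - Dk α (N + 1) := by
    induction k, hk using Nat.le_induction with
    | base => rfl
    | succ k hk ih => rw [hconst k hk, ih]
  have hzero : Dk α N - Dk α (N + 1) = 0 :=
    tendsto_nhds_unique (tendsto_const_nhds.congr' <|
      eventually_atTop.2 ⟨N, fun k hk ↦ (hge k hk).symm⟩) hdiff
  linarith [Dk_succ_lt hirr h0 h1 N]

theorem drem_mem_Ico {α β : ℝ} (hβ : β ∈ Set.Ico 0 1) (i : ℕ) : drem α β i ∈ Set.Ico 0 1 := by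
  cases i with
  | zero => exact hβ
  | succ i => exact ⟨Int.fract_nonneg _, Int.fract_lt_one _⟩

theorem drem_succ (α β : ℝ) (i : ℕ) :
    drem α β (i + 1) = drem α β i / ncq α i - db α β (i + 1) := rfl

theorem drem_eq_zero_of_le {α β : ℝ} {m n : ℕ} (h : drem α β m = 0) (hmn : m ≤ n) :
    drem α β n = 0 := by
  induction n, hmn using Nat.le_induction with
  | base => exact h
  | succ n _ ih => simp [drem, ih]

theorem sum_db_mul_Dk_add {α : ℝ} (hne : ∀ i, ncq α i ≠ 0) (β : ℝ) (n : ℕ) :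
    ∑ k ∈ Finset.Icc 1 n, db α β k * Dk α k + Dk α n * drem α β n = β := by
  induction n with
  | zero => simp [Dk, drem]
  | succ n ih =>
    have hmul : ncq α n * (drem α β n / ncq α n) = drem α β n := mul_div_cancel₀ _ (hne n)
    rw [Finset.sum_Icc_succ_top (by omega), drem_succ, Dk_succ]
    linear_combination ih + Dk α n * hmul

theorem drem_eq_zero_of_db_eq_zero {α β : ℝ} (hirr : Irrational α) (h0 : 0 < α) (h1 : α < 1)
    (hβ : β ∈ Set.Ico 0 1) {n : ℕ} (hn : ∀ i, n < i → db α β i = 0) : drem α β n = 0 := by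
  have hconst (k : ℕ) (hk : n ≤ k) : Dk α n * drem α β n = Dk α k * drem α β k := by
    induction k, hk using Nat.le_induction with
    | base => rfl
    | succ k hk ih =>
      have := (ncq_irrational_and_mem_Ioo hirr h0 h1 k).2.1.ne'
      rw [ih, drem_succ, hn _ (by omega), Dk_succ]
      field_simp
      simp
  have hle : Dk α n * drem α β n ≤ 0 := by
    refine ge_of_tendsto (tendsto_Dk_atTop hirr h0 h1) (eventually_atTop.2 ⟨n, fun k hk ↦ ?_⟩)
    rw [hconst k hk]
    exact mul_le_of_le_one_right (Dk_pos hirr h0 h1 k).le (drem_mem_Ico hβ k).2.le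
  exact le_antisymm (nonpos_of_mul_nonpos_right hle (Dk_pos hirr h0 h1 n)) (drem_mem_Ico hβ n).1

theorem eq_sum_nq_mul_sub_sum_np {α β : ℝ} (hirr : Irrational α) (h0 : 0 < α) (h1 : α < 1)
    {n : ℕ} (hn : drem α β n = 0) :
    β = (∑ k ∈ Finset.Icc 1 n, db α β k * nq α (k - 1) : ℤ) * α -
      (∑ k ∈ Finset.Icc 1 n, db α β k * np α (k - 1) : ℤ) := by
  have h := sum_db_mul_Dk_add (fun i ↦ (ncq_irrational_and_mem_Ioo hirr h0 h1 i).2.1.ne') β n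
  rw [hn, mul_zero, add_zero] at h
  push_cast
  rw [Finset.sum_mul, ← Finset.sum_sub_distrib]
  conv_lhs => rw [← h]
  refine Finset.sum_congr rfl fun k hk ↦ ?_
  obtain ⟨j, rfl⟩ := Nat.exists_eq_add_of_le' (Finset.mem_Icc.1 hk).1
  rw [Dk_succ_eq_nq_mul_sub_np hirr h0 h1, Nat.add_sub_cancel]
  ring

theorem exists_drem_eq_zero {α β : ℝ} (hirr : Irrational α) (h0 : 0 < α) (h1 : α < 1)
    (hβ : β ∈ Set.Ico 0 1) (q : ℕ) (i : ℕ) (p : ℤ) (h : drem α β i = q * ncq α i - p) :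
    ∃ n, drem α β n = 0 := by
  induction q using Nat.strong_induction_on generalizing i p with
  | _ q ih =>
    obtain ⟨-, hpos, hlt⟩ := ncq_irrational_and_mem_Ioo hirr h0 h1 i
    obtain ⟨hr0, hr1⟩ := drem_mem_Ico (α := α) hβ i
    rcases q.eq_zero_or_pos with rfl | hq
    · refine ⟨i + 1, ?_⟩
      have hp0 : p = 0 := by
        have hneg : (-1 : ℝ) < p := by push_cast at h; linarith
        have hnonpos : (p : ℝ) ≤ 0 := by push_cast at h; linarith
        have : -1 < p := by exact_mod_cast hneg
        have : p ≤ 0 := by exact_mod_cast hnonpos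
        omega
      simp [drem, h, hp0]
    · have hq' : (1 : ℝ) ≤ q := by exact_mod_cast hq
      have hp0 : 0 ≤ p := by
        have : (-1 : ℝ) < p := by nlinarith
        have : -1 < p := by exact_mod_cast this
        omega
      lift p to ℕ using hp0
      have hpq : (p : ℝ) < q := by push_cast at h; nlinarith
      refine ih p (by exact_mod_cast hpq) (i + 1) (p * npq α (i + 1) - q + db α β (i + 1)) ?_
      have hmul := ncq_succ_mul hpos.ne'
      rw [drem_succ, h]
      push_cast
      field_simp
      linear_combination (p : ℝ) * -hmul

theorem Irrational.intCast_mul_sub_intCast_inj {α : ℝ} (hirr : Irrational α) {q p q' p' : ℤ}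
    (h : q * α - p = q' * α - p') : q = q' ∧ p = p' := by
  have hq : q = q' := by
    by_contra hne
    refine (hirr.intCast_mul (sub_ne_zero.2 hne)).ne_int (p - p') ?_
    push_cast
    linarith
  subst hq
  exact ⟨rfl, by exact_mod_cast sub_right_injective h⟩

/-- For irrational `0 < α < 1` and `0 < β < 1` with Davenport coefficients
`b`, there exist integers `q ≥ 1` and `p` with `β = qα − p` iff the coefficients are
eventually zero; and in that case `q = Σ_{k=1}^n b_k q_{k−1}`, `p = Σ_{k=1}^n b_k p_{k−1}`. -/
theorem stmt10 (α : ℝ) (hirr : Irrational α) (h0 : 0 < α) (h1 : α < 1)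
    (β : ℝ) (hβ0 : 0 < β) (hβ1 : β < 1) :
    ((∃ q p : ℤ, 1 ≤ q ∧ β = q * α - p) ↔
      ∃ n : ℕ, 1 ≤ n ∧ ∀ i : ℕ, n < i → db α β i = 0) ∧
    (∀ q p : ℤ, 1 ≤ q → β = q * α - p →
      ∀ n : ℕ, 1 ≤ n → (∀ i : ℕ, n < i → db α β i = 0) →
        q = ∑ k ∈ Finset.Icc 1 n, db α β k * nq α (k - 1) ∧
        p = ∑ k ∈ Finset.Icc 1 n, db α β k * np α (k - 1)) := by
  have hβ : β ∈ Set.Ico 0 1 := ⟨hβ0.le, hβ1⟩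
  refine ⟨⟨?_, ?_⟩, ?_⟩
  · rintro ⟨q, p, hq, h⟩
    lift q to ℕ using by omega
    obtain ⟨n, hn⟩ := exists_drem_eq_zero hirr h0 h1 hβ q 0 p (by simpa [drem, ncq] using h)
    refine ⟨n + 1, by omega, fun i hi ↦ ?_⟩
    simp [db, drem_eq_zero_of_le hn (show n ≤ i - 1 by omega)]
  · rintro ⟨n, -, hn⟩
    have h := eq_sum_nq_mul_sub_sum_np hirr h0 h1 (drem_eq_zero_of_db_eq_zero hirr h0 h1 hβ hn)
    refine ⟨_, _, ?_, h⟩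
    have hnonneg : 0 ≤ ∑ k ∈ Finset.Icc 1 n, db α β k * nq α (k - 1) :=
      Finset.sum_nonneg fun k _ ↦ mul_nonneg
        (Int.floor_nonneg.2 (div_nonneg (drem_mem_Ico hβ _).1
          (ncq_irrational_and_mem_Ioo hirr h0 h1 _).2.1.le))
        (zero_le_one.trans (one_le_nq hirr h0 h1 _))
    refine lt_of_le_of_ne hnonneg fun hzero ↦ ?_
    rw [← hzero, Int.cast_zero, zero_mul, zero_sub, ← Int.cast_neg] at h
    rw [h] at hβ0 hβ1
    norm_cast at hβ0 hβ1
    omega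
  · intro q p _ h n _ hn
    exact hirr.intCast_mul_sub_intCast_inj (h.symm.trans
      (eq_sum_nq_mul_sub_sum_np hirr h0 h1 (drem_eq_zero_of_db_eq_zero hirr h0 h1 hβ hn)))
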